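/- Let C be a projective 16-divisible binary linear code of effective length 131. If c ∈ C has Hamming weight 80 and c' ∈ C has Hamming weight 16 or 32, then the support of c' is contained in the support of c: every coordinate i with c'_i ≠ 0 satisfies c_i ≠ 0. -/

import Mathlib

/-- Hamming weight of a binary vector. -/
def hwt {n : ℕ} (c : Fin n → ZMod 2) : ℕ :=
  (Finset.univ.filter fun i => c i ≠ 0).card

namespace SC

open Finset

def chi (a : ZMod 2) : ℤ := if a = 0 then 1 else -1

theorem chi_add (a b : ZMod 2) : chi (a + b) = chi a * chi b := by
  revert a b; decide

def Good {ι : Type} (C : Submodule (ZMod 2) (ι → ZMod 2)) : Prop :=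
  (∀ i, ∃ c ∈ C, c i ≠ 0) ∧ (∀ i j, i ≠ j → ∃ c ∈ C, c i ≠ c j)

noncomputable def s {ι : Type} [Fintype ι] (x : ι → ZMod 2) : ℤ := ∑ i, chi (x i)

theorem s_eq {ι : Type} [Fintype ι] (x : ι → ZMod 2) :
    s x = Fintype.card ι - 2 * (hammingNorm x : ℤ) := by
  have h : ∀ i, chi (x i) = 1 - 2 * (if x i ≠ 0 then 1 else 0) := by
    intro i; unfold chi; by_cases h : x i = 0 <;> simp [h]
  unfold s hammingNorm
  simp_rw [h, Finset.sum_sub_distrib, ← Finset.mul_sum, Finset.sum_boole]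
  simp

theorem charsum {V : Type*} [AddCommGroup V] [Fintype V] (f : V →+ ZMod 2) :
    ((∃ x, f x ≠ 0) → ∑ x, chi (f x) = 0) ∧
    ((∀ x, f x = 0) → ∑ x, chi (f x) = Fintype.card V) := by
  constructor
  · rintro ⟨y, hy⟩
    have h1 : ∑ x, chi (f (x + y)) = ∑ x, chi (f x) :=
      Equiv.sum_comp (Equiv.addRight y) (fun x => chi (f x))
    have h2 : chi (f y) = -1 := by simp [chi, hy]
    simp_rw [map_add, chi_add, h2] at h1
    rw [← Finset.sum_mul] at h1
    linarith
  · intro h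
    simp [h, chi]

section
variable {ι : Type} [Fintype ι] (C : Submodule (ZMod 2) (ι → ZMod 2)) [Fintype C]

def ev (i : ι) : C →+ ZMod 2 where
  toFun x := x.1 i
  map_zero' := rfl
  map_add' _ _ := rfl

theorem sum1 (h : Good C) : ∑ x : C, s x.1 = 0 := by
  unfold s
  rw [Finset.sum_comm]
  apply Finset.sum_eq_zero
  intro i _
  obtain ⟨c, hc, hi⟩ := h.1 i
  exact (charsum (ev C i)).1 ⟨⟨c, hc⟩, hi⟩

theorem sum2 (h : Good C) :
    ∑ x : C, s x.1 ^ 2 = Fintype.card ι * Fintype.card C := by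
  classical
  unfold s
  simp_rw [sq, Finset.sum_mul_sum]
  rw [Finset.sum_comm]
  have : ∀ i : ι, ∑ x : C, ∑ j, chi (x.1 i) * chi (x.1 j) = Fintype.card C := by
    intro i
    rw [Finset.sum_comm, Finset.sum_eq_single i]
    · have := (charsum (ev C i + ev C i)).2 (fun x => CharTwo.add_self_eq_zero _)
      rw [← this]
      exact Finset.sum_congr rfl fun x _ => (chi_add _ _).symm
    · intro j _ hj
      obtain ⟨c, hc, hi⟩ := h.2 i j hj.symm
      have := (charsum (ev C i + ev C j)).1 ⟨⟨c, hc⟩, fun h0 => hi (CharTwo.add_eq_zero.1 h0)⟩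
      rw [← this]
      exact Finset.sum_congr rfl fun x _ => (chi_add _ _).symm
    · simp
  simp [this]

theorem sum3 : ∃ T : ℕ, ∑ x : C, s x.1 ^ 3 = T * Fintype.card C := by
  classical
  have key : ∀ i j k : ι, ∃ t : ℕ,
      ∑ x : C, chi (x.1 i) * chi (x.1 j) * chi (x.1 k) = t * Fintype.card C := by
    intro i j k
    have e : ∑ x : C, chi (x.1 i) * chi (x.1 j) * chi (x.1 k)
        = ∑ x : C, chi ((ev C i + ev C j + ev C k) x) :=
      Finset.sum_congr rfl fun x _ => by rw [← chi_add, ← chi_add]; rfl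
    rw [e]
    by_cases hx : ∃ x, (ev C i + ev C j + ev C k) x ≠ 0
    · exact ⟨0, by rw [(charsum _).1 hx]; simp⟩
    · push Not at hx
      exact ⟨1, by rw [(charsum _).2 hx]; simp⟩
  choose t ht using key
  refine ⟨∑ i, ∑ j, ∑ k, t i j k, ?_⟩
  have e : ∀ x : C, s x.1 ^ 3 = ∑ i, ∑ j, ∑ k, chi (x.1 i) * chi (x.1 j) * chi (x.1 k) := by
    intro x
    unfold s
    rw [pow_succ, sq, Finset.sum_mul_sum, Finset.sum_mul]
    simp_rw [Finset.sum_mul_sum]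
  simp_rw [e]
  rw [Finset.sum_comm]
  push_cast
  rw [Finset.sum_mul]
  refine Finset.sum_congr rfl fun i _ => ?_
  rw [Finset.sum_comm, Finset.sum_mul]
  refine Finset.sum_congr rfl fun j _ => ?_
  rw [Finset.sum_comm, Finset.sum_mul]
  exact Finset.sum_congr rfl fun k _ => ht i j k

/-- second moment exclusion -/
theorem excl (h : Good C) (b c : ℤ) (hneg : Fintype.card ι + c < 0)
    (hx : ∀ x ∈ C, 0 ≤ s x ^ 2 + b * s x + c) : False := by
  have h0 : 0 ≤ ∑ x : C, (s x.1 ^ 2 + b * s x.1 + c) :=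
    Finset.sum_nonneg fun x _ => hx x.1 x.2
  rw [Finset.sum_add_distrib, Finset.sum_add_distrib, ← Finset.mul_sum, sum1 C h, sum2 C h] at h0
  simp only [Finset.sum_const, Finset.card_univ, nsmul_eq_mul] at h0
  have hN : (0 : ℤ) < Fintype.card C := by exact_mod_cast Fintype.card_pos
  nlinarith
end

/-- residual code -/
def res {ι : Type} (C : Submodule (ZMod 2) (ι → ZMod 2)) (c : ι → ZMod 2) :
    Submodule (ZMod 2) ({i // c i = 0} → ZMod 2) :=
  C.map (LinearMap.funLeft (ZMod 2) (ZMod 2) Subtype.val)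

section
variable {ι : Type} [Fintype ι] (C : Submodule (ZMod 2) (ι → ZMod 2)) (c : ι → ZMod 2)

theorem res_good (h : Good C) : Good (res C c) := by
  constructor
  · intro i
    obtain ⟨d, hd, hi⟩ := h.1 i.1
    exact ⟨_, Submodule.mem_map_of_mem hd, hi⟩
  · intro i j hij
    obtain ⟨d, hd, hi⟩ := h.2 i.1 j.1 (fun e => hij (Subtype.ext e))
    exact ⟨_, Submodule.mem_map_of_mem hd, hi⟩

theorem wt_res (d : ι → ZMod 2) :
    hammingNorm d + hammingNorm (c + d) =
      hammingNorm c + 2 * hammingNorm (fun i : {i // c i = 0} => d i.1) := by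
  classical
  have h1 : hammingNorm (fun i : {i // c i = 0} => d i.1)
      = ∑ i, if c i = 0 ∧ d i ≠ 0 then 1 else 0 := by
    rw [Finset.sum_boole]
    unfold hammingNorm
    rw [← Finset.card_map (Function.Embedding.subtype _)]
    simp only [Nat.cast_id]
    congr 1
    ext i
    simp [and_comm]
  rw [h1]
  simp only [hammingNorm, Finset.card_filter, Finset.mul_sum]
  rw [← Finset.sum_add_distrib, ← Finset.sum_add_distrib]
  refine Finset.sum_congr rfl fun i _ => ?_
  simp only [Pi.add_apply]
  have two : ∀ a b : ZMod 2, a ≠ 0 → b ≠ 0 → a + b = 0 := by decide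
  by_cases ha : c i = 0
  · by_cases hb : d i = 0 <;> simp [ha, hb]
  · by_cases hb : d i = 0
    · simp [ha, hb]
    · simp [ha, hb, two _ _ ha hb]

theorem card_res : Fintype.card {i // c i = 0} + hammingNorm c = Fintype.card ι := by
  classical
  rw [Fintype.card_subtype, hammingNorm, Finset.card_filter_add_card_filter_not]
  rfl

theorem res_div (m : ℕ) (hdiv : ∀ x ∈ C, 2 * m ∣ hammingNorm x) (hc : c ∈ C) :
    ∀ x ∈ res C c, m ∣ hammingNorm x := by
  rintro _ ⟨d, hd, rfl⟩
  have h := wt_res c d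
  have h2 : 2 * m ∣ 2 * hammingNorm (fun i : {i // c i = 0} => d i.1) := by
    rw [← Nat.dvd_add_right (hdiv c hc), ← h]
    exact Nat.dvd_add (hdiv d hd) (hdiv _ (C.add_mem hc hd))
  exact Nat.dvd_of_mul_dvd_mul_left (by norm_num) h2
end

theorem excl_len {ι : Type} [Fintype ι] (C : Submodule (ZMod 2) (ι → ZMod 2)) (h : Good C)
    (n m a : ℕ) (hn : Fintype.card ι = n) 
    (hdiv : ∀ x ∈ C, m ∣ hammingNorm x)
    (hneg : (n : ℤ) + (n - 2 * (m * a)) * (n - 2 * (m * (a + 1))) < 0) : False := by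
  classical
  have : Fintype C := Fintype.ofFinite C
  refine excl C h (-((n - 2 * (m * a)) + (n - 2 * (m * (a + 1)))))
    ((n - 2 * (m * a)) * (n - 2 * (m * (a + 1)))) (by rw [hn]; exact hneg) ?_
  intro x hx
  obtain ⟨k, hk⟩ := hdiv x hx
  rw [s_eq, hn, hk]
  have h1 : (0 : ℤ) ≤ ((k : ℤ) - a) * (k - (a + 1)) := by
    rcases le_or_gt k a with hka | hka
    · have : (k : ℤ) ≤ a := by exact_mod_cast hka
      nlinarith
    · have : (a : ℤ) + 1 ≤ k := by exact_mod_cast hka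
      nlinarith
  push_cast
  have h2 : (0 : ℤ) ≤ (2 * m) ^ 2 * (((k : ℤ) - a) * (k - (a + 1))) := by positivity
  linarith

theorem len51 {ι : Type} [Fintype ι] (C : Submodule (ZMod 2) (ι → ZMod 2)) (h : Good C)
    (hn : Fintype.card ι = 51) (hdiv : ∀ x ∈ C, 8 ∣ hammingNorm x) :
    ∀ x ∈ C, hammingNorm x < 24 → x = 0 := by
  classical
  have : Fintype C := Fintype.ofFinite C
  have hw : ∀ x ∈ C, x = 0 ∨ hammingNorm x = 8 ∨ hammingNorm x = 16 ∨ hammingNorm x = 24 ∨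
      hammingNorm x = 32 := by
    intro x hx
    have hcard := card_res x
    rw [hn] at hcard
    have hd := hdiv x hx
    have hr := res_div C x 4 (by simpa using hdiv) hx
    have g := res_good C x h
    have n0 : hammingNorm x = 0 → x = 0 := hammingNorm_eq_zero.1
    have n40 : hammingNorm x ≠ 40 := fun e =>
      excl_len _ g 11 4 1 (by omega) hr (by norm_num)
    have n48 : hammingNorm x ≠ 48 := fun e =>
      excl_len _ g 3 4 0 (by omega) hr (by norm_num)
    by_cases hx0 : x = 0
    · exact Or.inl hx0
    · have : hammingNorm x ≠ 0 := fun e => hx0 (n0 e)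
      omega
  set A := (Finset.univ.filter fun x : C => hammingNorm x.1 = 8).card with hA
  set B := (Finset.univ.filter fun x : C => hammingNorm x.1 = 16).card with hB
  have z0 : (Finset.univ.filter fun x : C => x = 0).card = 1 := by simp [Finset.filter_eq']
  have m1 := sum1 C h
  have m2 := sum2 C h
  obtain ⟨T, m3⟩ := sum3 C
  rw [hn] at m2
  set N := Fintype.card C with hN
  have e1 : ∀ x : C, s x.1 ^ 2 + 10 * s x.1 - 39 = 3072 * (if x = 0 then 1 else 0)
      + 1536 * (if hammingNorm x.1 = 8 then 1 else 0)
      + 512 * (if hammingNorm x.1 = 16 then 1 else 0) := by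
    intro x
    rw [s_eq, hn]
    rcases hw x.1 x.2 with e | e | e | e | e
    · have : x = 0 := Subtype.ext e
      subst this; simp
    all_goals
      have hx : x ≠ 0 := by rintro rfl; simp at e
      simp [e, hx]
  have e2 : ∀ x : C, s x.1 ^ 3 - 9 * s x.1 ^ 2 - 229 * s x.1 + 741
      = 98304 * (if x = 0 then 1 else 0)
      + 24576 * (if hammingNorm x.1 = 8 then 1 else 0) := by
    intro x
    rw [s_eq, hn]
    rcases hw x.1 x.2 with e | e | e | e | e
    · have : x = 0 := Subtype.ext e
      subst this; simp
    all_goals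
      have hx : x ≠ 0 := by rintro rfl; simp at e
      simp [e, hx]
  have f1 := Finset.sum_congr (rfl : (Finset.univ : Finset C) = Finset.univ) fun x _ => e1 x
  have f2 := Finset.sum_congr (rfl : (Finset.univ : Finset C) = Finset.univ) fun x _ => e2 x
  simp only [Finset.sum_add_distrib, Finset.sum_sub_distrib, ← Finset.mul_sum, m1, m2, m3,
    Finset.sum_boole, z0, ← hA, ← hB, Finset.sum_const, Finset.card_univ, nsmul_eq_mul, ← hN]
    at f1 f2
  push_cast at f1 f2
  have hcardpow : ∃ k, N = 2 ^ k := by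
    refine ⟨Module.finrank (ZMod 2) C, ?_⟩
    have := Module.card_eq_pow_finrank (K := ZMod 2) (V := C)
    rwa [ZMod.card] at this
  obtain ⟨k, hk⟩ := hcardpow
  have g1 : 256 ≤ N := by zify; linarith [Nat.cast_nonneg (α := ℤ) A, Nat.cast_nonneg (α := ℤ) B]
  have g2 : N ≤ 546 := by
    zify
    have : (N : ℤ) * (T + 90) ≤ 49152 := by nlinarith [Nat.cast_nonneg (α := ℤ) B]
    have t0 : (0 : ℤ) ≤ N * T := by positivity
    linarith
  have hk8 : 8 ≤ k := by
    by_contra hlt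
    have : 2 ^ k ≤ 2 ^ 7 := Nat.pow_le_pow_right (by norm_num) (by omega)
    omega
  have hk9 : k ≤ 9 := by
    by_contra hlt
    have : 2 ^ 10 ≤ 2 ^ k := Nat.pow_le_pow_right (by norm_num) (by omega)
    omega
  have AB : A = 0 ∧ B = 0 := by
    obtain rfl | rfl : k = 8 ∨ k = 9 := by omega
    · norm_num at hk
      rw [hk] at f1 f2
      push_cast at f1 f2
      constructor <;> omega
    · exfalso
      norm_num at hk
      rw [hk] at f1 f2
      push_cast at f1 f2
      have hA2 : A = 2 := by omega
      have hB0 : B = 0 := by omega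
      rw [hB, Finset.card_eq_zero, Finset.filter_eq_empty_iff] at hB0
      obtain ⟨u, v, huv, hs⟩ := Finset.card_eq_two.1 (hA.symm.trans hA2)
      have hu : hammingNorm u.1 = 8 := by
        have : u ∈ ({u, v} : Finset C) := by simp
        rw [← hs] at this; simpa using this
      have hv : hammingNorm v.1 = 8 := by
        have : v ∈ ({u, v} : Finset C) := by simp
        rw [← hs] at this; simpa using this
      have hsum := wt_res u.1 v.1
      have hle : hammingNorm (u.1 + v.1) ≤ 16 := by
        have := wt_res v.1 u.1
        have h3 : hammingNorm (fun i : {i // u.1 i = 0} => v.1 i.1) ≤ 8 := by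
          rw [← hv]
          unfold hammingNorm
          rw [← Finset.card_map (Function.Embedding.subtype _)]
          apply Finset.card_le_card
          intro i
          simp +contextual
        omega
      rcases hw _ (u + v).2 with e | e | e | e | e
      · apply huv
        have : u + v = 0 := Subtype.ext e
        have e' := congrArg Subtype.val this
        apply Subtype.ext
        funext i
        exact CharTwo.add_eq_zero.1 (congrFun e' i)
      · have : u + v ∈ ({u, v} : Finset C) := by rw [← hs]; simpa using e
        simp only [Finset.mem_insert, Finset.mem_singleton] at this
        rcases this with e | e
        · have : v = 0 := by simpa using e
          rw [this] at hv; simp at hv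
        · have : u = 0 := by simpa using e
          rw [this] at hu; simp at hu
      · exact hB0 (Finset.mem_univ _) e
      · rw [Submodule.coe_add] at e; omega
      · rw [Submodule.coe_add] at e; omega
  obtain ⟨hA0, hB0⟩ := AB
  rw [hB, Finset.card_eq_zero, Finset.filter_eq_empty_iff] at hB0
  rw [hA, Finset.card_eq_zero, Finset.filter_eq_empty_iff] at hA0
  intro x hx hlt
  rcases hw x hx with e | e | e | e | e
  · exact e
  · exact absurd e (hA0 (Finset.mem_univ ⟨x, hx⟩))
  · exact absurd e (hB0 (Finset.mem_univ ⟨x, hx⟩))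
  · omega
  · omega

end SC

/-- In a projective 16-divisible binary linear code of effective length 131, the support
of any codeword of weight 16 or 32 is contained in the support of any codeword of
weight 80. -/
theorem support_containment (C : Submodule (ZMod 2) (Fin 131 → ZMod 2))
    (heff : ∀ i : Fin 131, ∃ c ∈ C, c i ≠ 0)
    (hproj : ∀ i j : Fin 131, i ≠ j → ∃ c ∈ C, c i ≠ c j)
    (hdiv : ∀ c ∈ C, 16 ∣ hwt c)
    (c c' : Fin 131 → ZMod 2) (hc : c ∈ C) (hc' : c' ∈ C)
    (hwc : hwt c = 80) (hwc' : hwt c' = 16 ∨ hwt c' = 32) :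
    ∀ i : Fin 131, c' i ≠ 0 → c i ≠ 0 := by
  have hh : ∀ x : Fin 131 → ZMod 2, hwt x = hammingNorm x := fun x => by
    unfold hwt hammingNorm; congr
  simp only [hh] at hdiv hwc hwc'
  have g : SC.Good C := ⟨heff, hproj⟩
  have hmem := C.add_mem hc hc'
  have hle : hammingNorm (c + c') ≤ 80 := by
    have hcard := SC.card_res (c + c')
    rw [Fintype.card_fin] at hcard
    have hd := hdiv _ hmem
    have hr := SC.res_div C (c + c') 8 (by simpa using hdiv) hmem
    have g' := SC.res_good C (c + c') g
    have n1 : hammingNorm (c + c') ≠ 96 := fun e =>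
      SC.excl_len _ g' 35 8 2 (by omega) hr (by norm_num)
    have n2 : hammingNorm (c + c') ≠ 112 := fun e =>
      SC.excl_len _ g' 19 8 1 (by omega) hr (by norm_num)
    have n3 : hammingNorm (c + c') ≠ 128 := fun e =>
      SC.excl_len _ g' 3 8 0 (by omega) hr (by norm_num)
    omega
  have hcard := SC.card_res c
  rw [Fintype.card_fin, hwc] at hcard
  have hw := SC.wt_res c c'
  have hz := SC.len51 (SC.res C c) (SC.res_good C c g) (by omega)
    (SC.res_div C c 8 (by simpa using hdiv) hc)
    (fun i : {i // c i = 0} => c' i.1) ⟨c', hc', rfl⟩ (by omega)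
  intro i hi h0
  exact hi (congrFun hz ⟨i, h0⟩)
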